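/- Let X be a Gaussian random variable with mean μ and variance σ² > 0, and let GELU(x) = x·Φ(x). Then E[GELU(X)] = μ · Φ(μ/√(1 + σ²)) + (σ²/√(1 + σ²)) · φ(μ/√(1 + σ²)). -/

import Mathlib

open MeasureTheory ProbabilityTheory Real

/-- The standard normal density `φ(z) = exp(-z²/2)/√(2π)`. -/
noncomputable def stdNormalPDF (z : ℝ) : ℝ := Real.exp (-(z ^ 2) / 2) / Real.sqrt (2 * Real.pi)

/-- The standard normal CDF `Φ(x) = ∫_{-∞}^x φ(z) dz`. -/
noncomputable def stdNormalCDF (x : ℝ) : ℝ := ∫ z in Set.Iic x, stdNormalPDF z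

open scoped NNReal

theorem stdNormalPDF_eq_gaussianPDFReal : stdNormalPDF = gaussianPDFReal 0 1 := by
  ext z
  simp [stdNormalPDF, gaussianPDFReal, div_eq_inv_mul]

theorem integrable_stdNormalPDF : Integrable stdNormalPDF :=
  stdNormalPDF_eq_gaussianPDFReal ▸ integrable_gaussianPDFReal 0 1

theorem continuous_stdNormalPDF : Continuous stdNormalPDF := by
  unfold stdNormalPDF
  fun_prop

theorem norm_stdNormalPDF_le_one (x : ℝ) : ‖stdNormalPDF x‖ ≤ 1 := by
  have hpi : 1 ≤ √(2 * π) := Real.one_le_sqrt.2 (by linarith [Real.pi_gt_three])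
  rw [stdNormalPDF, Real.norm_of_nonneg (by positivity)]
  refine div_le_one_of_le₀ (le_trans ?_ hpi) (by positivity)
  exact Real.exp_le_one_iff.2 (by linarith [sq_nonneg x])

theorem stdNormalCDF_eq_measureReal (x : ℝ) :
    stdNormalCDF x = (gaussianReal 0 1).real (Set.Iic x) := by
  rw [stdNormalCDF, measureReal_def, gaussianReal_apply_eq_integral 0 one_ne_zero,
    stdNormalPDF_eq_gaussianPDFReal,
    ENNReal.toReal_ofReal (integral_nonneg fun _ => gaussianPDFReal_nonneg _ _ _)]

theorem hasDerivAt_stdNormalCDF (x : ℝ) : HasDerivAt stdNormalCDF (stdNormalPDF x) x := by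
  have h : stdNormalCDF = fun y => stdNormalCDF 0 + ∫ z in (0 : ℝ)..y, stdNormalPDF z := by
    ext y
    rw [← intervalIntegral.integral_Iic_sub_Iic integrable_stdNormalPDF.integrableOn
      integrable_stdNormalPDF.integrableOn]
    simp [stdNormalCDF]
  rw [h]
  exact (continuous_stdNormalPDF.integral_hasStrictDerivAt 0 x).hasDerivAt.const_add _

theorem continuous_stdNormalCDF : Continuous stdNormalCDF :=
  continuous_iff_continuousAt.2 fun x => (hasDerivAt_stdNormalCDF x).continuousAt

theorem norm_stdNormalCDF_le_one (x : ℝ) : ‖stdNormalCDF x‖ ≤ 1 := by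
  rw [stdNormalCDF_eq_measureReal, Real.norm_of_nonneg measureReal_nonneg]
  exact measureReal_le_one

theorem integrable_mul_stdNormalCDF {ν : Measure ℝ} {f : ℝ → ℝ} (hf : Integrable f ν) :
    Integrable (fun x => f x * stdNormalCDF x) ν :=
  hf.mul_bdd continuous_stdNormalCDF.aestronglyMeasurable
    (Filter.Eventually.of_forall norm_stdNormalCDF_le_one)

/-- `P(Y ≤ 0) = Φ(μ / s)` for `Y ~ N(-μ, s²)`. -/
theorem gaussianReal_neg_real_Iic_zero (μ : ℝ) {s : ℝ} (hs : 0 < s) {w : ℝ≥0}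
    (hw : (w : ℝ) = s ^ 2) :
    (gaussianReal (-μ) w).real (Set.Iic 0) = stdNormalCDF (μ / s) := by
  have h : gaussianReal (-μ) w = ((gaussianReal 0 1).map (s * ·)).map (· + -μ) := by
    rw [gaussianReal_map_const_mul, gaussianReal_map_add_const]
    congr 1
    · simp
    · ext
      simp [hw]
  rw [h, Measure.map_map (by fun_prop) (by fun_prop), stdNormalCDF_eq_measureReal,
    map_measureReal_apply (by fun_prop) measurableSet_Iic]
  congr 1
  ext x
  simp only [Set.mem_preimage, Set.mem_Iic, Function.comp_apply, le_div_iff₀ hs]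
  constructor <;> intro h <;> linarith

theorem integral_stdNormalCDF_gaussianReal (μ : ℝ) (v : ℝ≥0) :
    ∫ x, stdNormalCDF x ∂(gaussianReal μ v) = stdNormalCDF (μ / √(1 + v)) := by
  rw [← gaussianReal_neg_real_Iic_zero μ (s := √(1 + v)) (w := v + 1) (by positivity)
    (by rw [Real.sq_sqrt (by positivity)]; push_cast; ring)]
  have hconv := gaussianReal_conv_gaussianReal (m₁ := -μ) (m₂ := 0) (v₁ := v) (v₂ := 1)
  rw [add_zero] at hconv
  rw [← hconv, ← integral_indicator_one measurableSet_Iic, integral_conv ((integrable_const 1).indicator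
    measurableSet_Iic), ← gaussianReal_map_neg]
  refine Eq.trans ?_ ((Homeomorph.neg ℝ).measurableEmbedding.integral_map _).symm
  congr 1 with x
  rw [stdNormalCDF_eq_measureReal, ← integral_indicator_one measurableSet_Iic]
  congr 1 with y
  simp [Set.indicator_apply]

theorem hasDerivAt_gaussianPDFReal (μ : ℝ) {v : ℝ≥0} (hv : v ≠ 0) (x : ℝ) :
    HasDerivAt (gaussianPDFReal μ v) (-((x - μ) / v * gaussianPDFReal μ v x)) x := by
  have hv' : (v : ℝ) ≠ 0 := by exact_mod_cast hv
  have h : HasDerivAt (fun y : ℝ => -(y - μ) ^ 2 / (2 * v)) (-((x - μ) / v)) x := by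
    refine (((((hasDerivAt_id' x).sub_const μ).pow 2).fun_neg).div_const
      (2 * (v : ℝ))).congr_deriv ?_
    push_cast
    field_simp
  refine (h.exp.const_mul (√(2 * π * v))⁻¹).congr_deriv ?_
  rw [gaussianPDFReal_def]
  ring

theorem integrable_sub_gaussianReal (μ : ℝ) (v : ℝ≥0) :
    Integrable (fun x => x - μ) (gaussianReal μ v) :=
  (memLp_one_iff_integrable.1 (memLp_id_gaussianReal 1)).sub (integrable_const μ)

/-- Integration by parts against a Gaussian density (Stein's identity). -/
theorem integral_sub_mul_stdNormalCDF_gaussianReal (μ : ℝ) {v : ℝ≥0} (hv : v ≠ 0) :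
    ∫ x, (x - μ) * stdNormalCDF x ∂(gaussianReal μ v) =
      v * ∫ x, stdNormalPDF x ∂(gaussianReal μ v) := by
  have hv' : (v : ℝ) ≠ 0 := by exact_mod_cast hv
  have hderiv (x : ℝ) : HasDerivAt (fun y => -(v * gaussianPDFReal μ v y))
      ((x - μ) * gaussianPDFReal μ v x) x := by
    refine ((hasDerivAt_gaussianPDFReal μ hv x).const_mul (v : ℝ)).fun_neg.congr_deriv ?_
    field_simp
  have hpdf : Integrable (fun x => -(v * gaussianPDFReal μ v x)) :=
    ((integrable_gaussianPDFReal μ v).const_mul _).neg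
  have hmean : Integrable (fun x => (x - μ) * gaussianPDFReal μ v x) := by
    have h := integrable_sub_gaussianReal μ v
    rw [gaussianReal_of_var_ne_zero _ hv, integrable_withDensity_iff_integrable_smul'
      (measurable_gaussianPDF μ v) (ae_of_all _ fun _ => gaussianPDF_lt_top)] at h
    simpa only [toReal_gaussianPDF, smul_eq_mul, mul_comm] using h
  have hparts := integral_mul_deriv_eq_deriv_mul_of_integrable
    (fun x _ => hasDerivAt_stdNormalCDF x) (fun x _ => hderiv x)
    ((integrable_mul_stdNormalCDF hmean).congr (ae_of_all _ fun x => mul_comm _ _))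
    (hpdf.bdd_mul (c := 1) continuous_stdNormalPDF.aestronglyMeasurable
      (ae_of_all _ norm_stdNormalPDF_le_one))
    ((integrable_mul_stdNormalCDF hpdf).congr (ae_of_all _ fun x => mul_comm _ _))
  rw [integral_gaussianReal_eq_integral_smul hv, integral_gaussianReal_eq_integral_smul hv,
    ← integral_const_mul]
  calc ∫ x, gaussianPDFReal μ v x • ((x - μ) * stdNormalCDF x)
      = ∫ x, stdNormalCDF x * ((x - μ) * gaussianPDFReal μ v x) := by
        congr 1 with x
        rw [smul_eq_mul]
        ring
    _ = ∫ x, v * gaussianPDFReal μ v x • stdNormalPDF x := by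
        rw [hparts, ← integral_neg]
        congr 1 with x
        rw [smul_eq_mul]
        ring

/-- Completing the square in the product of two Gaussian densities. -/
theorem gaussianPDFReal_mul_stdNormalPDF (μ : ℝ) {v : ℝ≥0} (hv : v ≠ 0) (x : ℝ) :
    gaussianPDFReal μ v x * stdNormalPDF x =
      stdNormalPDF (μ / √(1 + v)) / √(1 + v) *
        gaussianPDFReal (μ / (1 + v)) (v / (1 + v)) x := by
  have hs : √(1 + (v : ℝ)) ^ 2 = 1 + v := Real.sq_sqrt (by positivity)
  have hexp : -(x - μ) ^ 2 / (2 * v) + -(x ^ 2) / 2 = -((μ / √(1 + v)) ^ 2) / 2 +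
      -(x - μ / (1 + v)) ^ 2 / (2 * (v / (1 + v))) := by
    rw [div_pow, hs]
    field_simp
    ring
  have hsqrt : √(2 * π * v) = √(1 + v) * √(2 * π * (v / (1 + v))) := by
    rw [← Real.sqrt_mul (by positivity)]
    congr 1
    field_simp
  have hE := congrArg Real.exp hexp
  rw [Real.exp_add, Real.exp_add] at hE
  simp only [gaussianPDFReal, stdNormalPDF, NNReal.coe_div, NNReal.coe_add, NNReal.coe_one]
  rw [hsqrt, mul_inv]
  linear_combination (√(1 + v))⁻¹ * (√(2 * π * (v / (1 + v))))⁻¹ * (√(2 * π))⁻¹ * hE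

theorem integral_stdNormalPDF_gaussianReal (μ : ℝ) {v : ℝ≥0} (hv : v ≠ 0) :
    ∫ x, stdNormalPDF x ∂(gaussianReal μ v) = stdNormalPDF (μ / √(1 + v)) / √(1 + v) := by
  rw [integral_gaussianReal_eq_integral_smul hv]
  simp_rw [smul_eq_mul, gaussianPDFReal_mul_stdNormalPDF μ hv]
  rw [integral_const_mul, integral_gaussianPDFReal_eq_one _ (by positivity), mul_one]

theorem integral_mul_stdNormalCDF_gaussianReal (μ : ℝ) {v : ℝ≥0} (hv : v ≠ 0) :
    ∫ x, x * stdNormalCDF x ∂(gaussianReal μ v) =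
      μ * stdNormalCDF (μ / √(1 + v)) + v / √(1 + v) * stdNormalPDF (μ / √(1 + v)) := by
  have hsplit (x : ℝ) : x * stdNormalCDF x = μ * stdNormalCDF x + (x - μ) * stdNormalCDF x := by
    ring
  simp_rw [hsplit]
  rw [integral_add (integrable_mul_stdNormalCDF (integrable_const μ))
    (integrable_mul_stdNormalCDF (integrable_sub_gaussianReal μ v)), integral_const_mul,
    integral_stdNormalCDF_gaussianReal, integral_sub_mul_stdNormalCDF_gaussianReal μ hv,
    integral_stdNormalPDF_gaussianReal μ hv]
  ring

/-- If `X ~ N(μ, σ²)` with `σ² > 0` and `GELU(x) = x Φ(x)`, then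
`E[GELU(X)] = μ Φ(μ/√(1+σ²)) + (σ²/√(1+σ²)) φ(μ/√(1+σ²))`. -/
theorem gelu_gaussian_mean (μ σ : ℝ) (hσ : 0 < σ) (GELU : ℝ → ℝ)
    (hGELU : GELU = fun x => x * stdNormalCDF x) :
    ∫ x, GELU x ∂(gaussianReal μ ⟨σ ^ 2, sq_nonneg σ⟩) =
      μ * stdNormalCDF (μ / Real.sqrt (1 + σ ^ 2)) +
        σ ^ 2 / Real.sqrt (1 + σ ^ 2) * stdNormalPDF (μ / Real.sqrt (1 + σ ^ 2)) := by
  lift σ to ℝ≥0 using hσ.le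
  have hv : σ ^ 2 ≠ 0 := pow_ne_zero 2 (by exact_mod_cast hσ.ne')
  have h := integral_mul_stdNormalCDF_gaussianReal μ hv
  rw [NNReal.coe_pow] at h
  rw [hGELU]
  exact h
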